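/- For real a, b, c > 0, (1/(4π²))·∫_0^∞ τ·sinh(πτ)·|Γ(a + iτ/2)·Γ(b + iτ/2)·Γ(c + iτ/2)|² dτ = Γ(a+b)·Γ(a+c)·Γ(b+c) (the limit case of the Wilson integral, i.e. the de Branges–Wilson integral with one parameter removed). -/

import Mathlib

open MeasureTheory Complex

lemma gz_ne (s : ℂ) (hs : 0 < s.re) (m : ℕ) : s ≠ -m := by
  intro h
  have := congrArg Complex.re h
  simp at this
  have : (0:ℝ) ≤ m := by positivity
  linarith

/-- monotonicity of `|Γ(c+ix)|/Γ(c)` in `c` -/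
lemma norm_Gamma_mono (c d y : ℝ) (hc : 0 < c) (hcd : c ≤ d) :
    ‖Complex.Gamma (c + y * I)‖ * Real.Gamma d ≤ ‖Complex.Gamma (d + y * I)‖ * Real.Gamma c := by
  have hd : 0 < d := hc.trans_le hcd
  have t1 := ((Complex.GammaSeq_tendsto_Gamma (c + y * I)).norm).mul (Real.GammaSeq_tendsto_Gamma d)
  have t2 := ((Complex.GammaSeq_tendsto_Gamma (d + y * I)).norm).mul (Real.GammaSeq_tendsto_Gamma c)
  refine le_of_tendsto_of_tendsto t1 t2 ?_
  filter_upwards [Filter.eventually_gt_atTop 0] with n hn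
  simp only [Complex.GammaSeq, Real.GammaSeq, norm_div, norm_mul, norm_prod]
  have hn' : (0:ℝ) < n := by exact_mod_cast hn
  have e : ∀ u : ℝ, ‖(n:ℂ) ^ ((u:ℂ) + y * I)‖ = (n:ℝ) ^ u := by
    intro u
    rw [← Complex.ofReal_natCast, Complex.norm_cpow_eq_rpow_re_of_pos hn']
    simp
  rw [e, e]
  have key : ∀ j : ℕ, ‖(d:ℂ) + y * I + j‖ * (c + j) ≤ ‖(c:ℂ) + y * I + j‖ * (d + j) := by
    intro j
    have hj : (0:ℝ) ≤ j := by positivity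
    have e2 : ∀ u : ℝ, ‖(u:ℂ) + y * I + j‖ = Real.sqrt ((u + j)^2 + y^2) := by
      intro u
      rw [← Complex.norm_add_mul_I]
      congr 1; push_cast; ring
    rw [e2, e2]
    apply le_of_sq_le_sq _ (by positivity)
    rw [mul_pow, mul_pow, Real.sq_sqrt (by positivity), Real.sq_sqrt (by positivity)]
    have : (c + j)^2 ≤ (d+j)^2 := by gcongr
    nlinarith [sq_nonneg y]
  have kp : (∏ j ∈ Finset.range (n+1), ‖(d:ℂ) + y * I + j‖) * (∏ j ∈ Finset.range (n+1), (c + j)) ≤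
      (∏ j ∈ Finset.range (n+1), ‖(c:ℂ) + y * I + j‖) * (∏ j ∈ Finset.range (n+1), (d + j)) := by
    rw [← Finset.prod_mul_distrib, ← Finset.prod_mul_distrib]
    exact Finset.prod_le_prod (fun j _ => by positivity) (fun j _ => key j)
  have pos : ∀ u : ℝ, 0 < u → 0 < ∏ j ∈ Finset.range (n+1), ‖(u:ℂ) + y * I + j‖ := by
    intro u hu
    refine Finset.prod_pos (fun j _ => norm_pos_iff.mpr ?_)
    intro h
    have := congrArg Complex.re h
    simp at this
    have : (0:ℝ) ≤ j := by positivity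
    linarith
  have p1 := pos c hc
  have p2 := pos d hd
  have p3 : 0 < ∏ j ∈ Finset.range (n+1), (c + (j:ℝ)) := Finset.prod_pos (fun j _ => by positivity)
  have p4 : 0 < ∏ j ∈ Finset.range (n+1), (d + (j:ℝ)) := Finset.prod_pos (fun j _ => by positivity)
  rw [div_mul_div_comm, div_mul_div_comm, div_le_div_iff₀ (by positivity) (by positivity)]
  have : 0 ≤ (n:ℝ)^c * ‖((n.factorial : ℕ):ℂ)‖ * ((n:ℝ)^d * (n.factorial:ℝ)) := by positivity
  calc _ ≤ (n:ℝ)^c * ‖((n.factorial : ℕ):ℂ)‖ * ((n:ℝ)^d * (n.factorial:ℝ)) * _ :=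
        mul_le_mul_of_nonneg_left kp this
    _ = _ := by ring

lemma normSq_Gamma_half (y : ℝ) :
    normSq (Complex.Gamma ((1/2:ℝ) + y * I)) = Real.pi / Real.cosh (Real.pi * y) := by
  have h := Complex.Gamma_mul_Gamma_one_sub ((1/2:ℝ) + y * I)
  have e : (1:ℂ) - ((1/2:ℝ) + y * I) = (starRingEnd ℂ) ((1/2:ℝ) + y * I) := by
    rw [map_add, map_mul, Complex.conj_ofReal, Complex.conj_ofReal, Complex.conj_I]
    push_cast; ring
  rw [e, Complex.Gamma_conj, Complex.mul_conj] at h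
  have e2 : Complex.sin (Real.pi * ((1/2:ℝ) + y * I)) = Real.cosh (Real.pi * y) := by
    rw [show (Real.pi:ℂ) * ((1/2:ℝ) + y * I) = (Real.pi * y : ℂ) * I + Real.pi/2 by push_cast; ring,
      Complex.sin_add_pi_div_two, Complex.cos_mul_I]
    push_cast; rfl
  rw [e2] at h
  exact_mod_cast h

lemma normSq_Gamma_one (y : ℝ) (hy : y ≠ 0) :
    normSq (Complex.Gamma ((1:ℝ) + y * I)) = Real.pi * y / Real.sinh (Real.pi * y) := by
  have h := Complex.Gamma_mul_Gamma_one_sub (y * I)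
  have hy' : (y:ℂ) * I ≠ 0 := by simp [hy]
  have g := Complex.Gamma_add_one (y*I) hy'
  have e : (1:ℂ) - (y * I) = (starRingEnd ℂ) ((1:ℝ) + y * I) := by
    simp; ring
  have e2 : Complex.sin (Real.pi * (y * I)) = Real.sinh (Real.pi * y) * I := by
    rw [show (Real.pi:ℂ) * (y * I) = (Real.pi * y : ℂ) * I by ring, Complex.sin_mul_I]
    push_cast; rfl
  have h2 : (normSq (Complex.Gamma ((1:ℝ) + y * I)) : ℂ) = 
     (Real.pi * y / Real.sinh (Real.pi * y) : ℝ) := by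
    rw [← Complex.mul_conj, ← Complex.Gamma_conj, ← e, 
      show ((1:ℝ):ℂ) + y * I = y * I + 1 by push_cast; ring, g, mul_assoc, h, e2]
    push_cast
    have : Complex.sinh (Real.pi * y) ≠ 0 := by
      have : Real.sinh (Real.pi * y) ≠ 0 := by
        rw [Ne, Real.sinh_eq_zero]; positivity
      exact_mod_cast this
    field_simp
  exact_mod_cast h2

lemma Gamma_half_bound (n : ℕ) : ∀ θ : ℝ, θ < Real.pi / 2 → ∃ C : ℝ, 0 ≤ C ∧ ∀ y : ℝ,
    ‖Complex.Gamma ((1/2 + n : ℝ) + y * I)‖ ≤ C * Real.exp (-(θ * |y|)) := by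
  induction n with
  | zero =>
    intro θ hθ
    refine ⟨Real.sqrt (2 * Real.pi), by positivity, fun y => ?_⟩
    apply le_of_sq_le_sq _ (by positivity)
    rw [← Complex.normSq_eq_norm_sq]
    have := normSq_Gamma_half y
    simp only [Nat.cast_zero, add_zero]
    rw [this, mul_pow, Real.sq_sqrt (by positivity), ← Real.exp_nat_mul, div_le_iff₀ (Real.cosh_pos _),
      ← Real.cosh_abs, abs_mul, abs_of_pos Real.pi_pos, Real.cosh_eq]
    have h1 : Real.exp (((2:ℕ):ℝ) * -(θ * |y|)) * Real.exp (Real.pi * |y|) ≥ 1 := by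
      rw [← Real.exp_add]
      apply Real.one_le_exp
      push_cast
      nlinarith [abs_nonneg y]
    have h2 : 0 < Real.exp (((2:ℕ):ℝ) * -(θ * |y|)) * Real.exp (-(Real.pi * |y|)) := by positivity
    have h3 := mul_le_mul_of_nonneg_left (add_le_add h1.le h2.le) Real.pi_pos.le
    generalize Real.exp (((2:ℕ):ℝ) * -(θ * |y|)) = u at *
    generalize Real.exp (Real.pi * |y|) = v at *
    generalize Real.exp (-(Real.pi * |y|)) = w at *
    calc Real.pi = Real.pi * (1 + 0) := by ring
      _ ≤ _ := h3
      _ = _ := by ring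
  | succ n ih =>
    intro θ hθ
    obtain ⟨θ', h1, h2⟩ := exists_between hθ
    obtain ⟨C, hC, h⟩ := ih θ' h2
    have hδ : 0 < θ' - θ := by linarith
    refine ⟨C * ((1/2 + n) + 1 / (θ' - θ)), by positivity, fun y => ?_⟩
    have hne : (((1/2 + n : ℝ)) + y * I : ℂ) ≠ 0 := by
      intro h
      have := congrArg Complex.re h
      simp at this
      have : (0:ℝ) ≤ n := by positivity
      linarith
    have := Complex.Gamma_add_one _ hne
    rw [show (((1/2 + (n+1:ℕ) : ℝ)) + y * I : ℂ) = ((1/2 + n : ℝ)) + y * I + 1 by push_cast; ring,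
      this, norm_mul]
    have b1 : ‖(((1/2 + n : ℝ)) + y * I : ℂ)‖ ≤ (1/2 + n) + |y| := by
      refine (norm_add_le _ _).trans ?_
      rw [norm_mul, Complex.norm_I, Complex.norm_real, Complex.norm_real, mul_one, Real.norm_eq_abs,
        Real.norm_eq_abs, abs_of_nonneg (by positivity : (0:ℝ) ≤ 1/2 + n)]
    have b2 : (1/2 + n:ℝ) + |y| ≤ ((1/2 + n) + 1 / (θ' - θ)) * Real.exp ((θ' - θ) * |y|) := by
      have e1 : 1 ≤ Real.exp ((θ' - θ) * |y|) := Real.one_le_exp (by positivity)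
      have e2 := Real.add_one_le_exp ((θ' - θ) * |y|)
      have e3 : |y| = 1 / (θ' - θ) * ((θ' - θ) * |y|) := by field_simp
      have e4 : |y| ≤ 1 / (θ' - θ) * Real.exp ((θ' - θ) * |y|) := by
        conv_lhs => rw [e3]
        gcongr; linarith
      have : (1/2 + n:ℝ) ≤ (1/2+n) * Real.exp ((θ' - θ) * |y|) := le_mul_of_one_le_right (by positivity) e1
      rw [add_mul]; linarith
    calc _ ≤ (((1/2 + n) + 1 / (θ' - θ)) * Real.exp ((θ' - θ) * |y|)) * (C * Real.exp (-(θ' * |y|))) := by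
          gcongr
          · exact b1.trans b2
          · exact h y
      _ = C * ((1/2 + n) + 1 / (θ' - θ)) * (Real.exp ((θ' - θ) * |y|) * Real.exp (-(θ' * |y|))) := by ring
      _ = _ := by rw [← Real.exp_add]; congr 2; ring

lemma Gamma_strip_bound (p q : ℝ) (hp : 0 < p) : ∃ C : ℝ, 0 ≤ C ∧ ∀ s : ℂ,
    p ≤ s.re → s.re ≤ q → ‖Complex.Gamma s‖ ≤ C * Real.exp (-(5/4 * |s.im|)) := by
  obtain ⟨n, hn⟩ := exists_nat_ge q
  obtain ⟨C, hC, h⟩ := Gamma_half_bound n (5/4) (by linarith [Real.pi_gt_d2])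
  have hcont : ContinuousOn Real.Gamma (Set.Icc p q) := fun x hx =>
    (Real.differentiableOn_Gamma_Ioi.continuousOn.mono
      (fun z hz => lt_of_lt_of_le hp hz.1)) x hx
  obtain ⟨M, hM⟩ := isCompact_Icc.exists_bound_of_continuousOn hcont
  have hG : 0 < Real.Gamma (1/2 + n) := Real.Gamma_pos_of_pos (by positivity)
  refine ⟨C * |M| / Real.Gamma (1/2 + n), by positivity, fun s h1 h2 => ?_⟩
  have hm := norm_Gamma_mono s.re (1/2 + n) s.im (by linarith) (by linarith)
  rw [Complex.re_add_im] at hm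
  have hb := h s.im
  have hM' : Real.Gamma s.re ≤ |M| := ((le_abs_self _).trans (hM s.re ⟨h1, h2⟩)).trans (le_abs_self _)
  have : 0 < Real.Gamma s.re := Real.Gamma_pos_of_pos (by linarith)
  rw [div_mul_eq_mul_div, le_div_iff₀ hG]
  refine hm.trans ?_
  calc _ ≤ (C * Real.exp (-(5/4 * |s.im|))) * |M| := by gcongr
    _ = _ := by ring

noncomputable def wg (a b c : ℝ) (s : ℂ) : ℂ :=
  Complex.Gamma (a + s) * Complex.Gamma (b + s) * Complex.Gamma (c + s) *
  (Complex.Gamma (a + 1 - s) * Complex.Gamma (b + 1 - s) * Complex.Gamma (c + 1 - s)) *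
  Complex.sin (2 * Real.pi * s)

lemma norm_sin_le (s : ℂ) : ‖Complex.sin (2 * Real.pi * s)‖ ≤ Real.exp (2 * Real.pi * |s.im|) := by
  rw [Complex.sin]
  have e1 : ‖Complex.exp (-(2 * Real.pi * s) * I)‖ ≤ Real.exp (2 * Real.pi * |s.im|) := by
    rw [Complex.norm_exp]
    apply Real.exp_le_exp.mpr
    simp
    nlinarith [Real.pi_pos, le_abs_self s.im]
  have e2 : ‖Complex.exp ((2 * Real.pi * s) * I)‖ ≤ Real.exp (2 * Real.pi * |s.im|) := by
    rw [Complex.norm_exp]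
    apply Real.exp_le_exp.mpr
    simp
    nlinarith [Real.pi_pos, neg_abs_le s.im]
  rw [norm_div, norm_mul, Complex.norm_I, mul_one]
  have := norm_sub_le (Complex.exp (-(2 * Real.pi * s) * I)) (Complex.exp ((2 * Real.pi * s) * I))
  simp only [Complex.norm_ofNat]
  linarith

lemma wg_bound (a b c : ℝ) (ha : 0 < a) (hb : 0 < b) (hc : 0 < c) : ∃ C : ℝ, 0 ≤ C ∧ ∀ s : ℂ,
    0 ≤ s.re → s.re ≤ 1 → ‖wg a b c s‖ ≤ C * Real.exp (-|s.im|) := by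
  obtain ⟨A, hA, h1⟩ := Gamma_strip_bound a (a+1) ha
  obtain ⟨B, hB, h2⟩ := Gamma_strip_bound b (b+1) hb
  obtain ⟨D, hD, h3⟩ := Gamma_strip_bound c (c+1) hc
  refine ⟨A * B * D * (A * B * D), by positivity, fun s s0 s1 => ?_⟩
  have A1 := h1 (a + s) (by simp; linarith) (by simp; linarith)
  have B1 := h2 (b + s) (by simp; linarith) (by simp; linarith)
  have D1 := h3 (c + s) (by simp; linarith) (by simp; linarith)
  have A2 := h1 (a + 1 - s) (by simp; linarith) (by simp; linarith)
  have B2 := h2 (b + 1 - s) (by simp; linarith) (by simp; linarith)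
  have D2 := h3 (c + 1 - s) (by simp; linarith) (by simp; linarith)
  simp only [add_im, sub_im, ofReal_im, one_im, zero_add, add_zero, zero_sub, abs_neg] at A1 B1 D1 A2 B2 D2
  have S := norm_sin_le s
  rw [wg]
  simp only [norm_mul]
  set E := Real.exp (-(5/4 * |s.im|))
  simp only [← norm_mul]
  calc _ ≤ (A * E) * (B * E) * (D * E) * ((A * E) * (B * E) * (D * E)) * Real.exp (2 * Real.pi * |s.im|) := by
        simp only [norm_mul] at S ⊢
        gcongr
    _ = A * B * D * (A * B * D) * (E ^ 6 * Real.exp (2 * Real.pi * |s.im|)) := by ring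
    _ ≤ _ := by
        gcongr
        rw [← Real.exp_nat_mul, ← Real.exp_add]
        apply Real.exp_le_exp.mpr
        push_cast
        nlinarith [abs_nonneg s.im, Real.pi_lt_d2]

lemma wg_diff (a b c : ℝ) (ha : 0 < a) (hb : 0 < b) (hc : 0 < c) (s : ℂ) (h0 : 0 ≤ s.re) (h1 : s.re ≤ 1) :
    DifferentiableAt ℂ (wg a b c) s := by
  have k1 : ∀ u : ℝ, 0 < u → DifferentiableAt ℂ (fun s : ℂ => Complex.Gamma (u + s)) s := by
    intro u hu
    exact (Complex.differentiableAt_Gamma _ (gz_ne _ (by simp; linarith))).comp s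
      (by fun_prop : DifferentiableAt ℂ (fun s : ℂ => (u:ℂ) + s) s)
  have k2 : ∀ u : ℝ, 0 < u → DifferentiableAt ℂ (fun s : ℂ => Complex.Gamma (u + 1 - s)) s := by
    intro u hu
    exact (Complex.differentiableAt_Gamma _ (gz_ne _ (by simp; linarith))).comp s
      (by fun_prop : DifferentiableAt ℂ (fun s : ℂ => (u:ℂ) + 1 - s) s)
  have := k1 a ha
  have := k1 b hb
  have := k1 c hc
  have := k2 a ha
  have := k2 b hb
  have := k2 c hc
  unfold wg
  fun_prop

lemma integrable_exp_neg_abs : Integrable (fun y : ℝ => Real.exp (-|y|)) := by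
  have h : IntegrableOn (fun y : ℝ => Real.exp (-y)) (Set.Ioi 0) := by
    simpa using exp_neg_integrableOn_Ioi 0 (one_pos)
  have h1 : IntegrableOn (fun y : ℝ => Real.exp (-|y|)) (Set.Ioi 0) :=
    h.congr_fun (fun y hy => by
      simp only [Set.mem_Ioi] at hy
      simp only [abs_of_pos hy]) measurableSet_Ioi
  have h2 : IntegrableOn (fun y : ℝ => Real.exp (-|y|)) (Set.Iic 0) := by
    rw [← integrableOn_Ici_iff_integrableOn_Ioi] at h1
    have h3 : Integrable ((Set.Ici (0:ℝ)).indicator (fun y : ℝ => Real.exp (-|y|))) :=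
      (integrable_indicator_iff measurableSet_Ici).mpr h1
    rw [← integrable_indicator_iff measurableSet_Iic]
    convert! h3.comp_neg using 1
    ext y
    simp [Set.indicator]
  rw [← integrableOn_univ, ← Set.Iic_union_Ioi (a := (0:ℝ))]
  exact h2.union h1

lemma wg_integrable (a b c : ℝ) (ha : 0 < a) (hb : 0 < b) (hc : 0 < c) (σ : ℝ) (h0 : 0 ≤ σ) (h1 : σ ≤ 1) :
    Integrable (fun y : ℝ => wg a b c (σ + y * I)) := by
  obtain ⟨C, hC, h⟩ := wg_bound a b c ha hb hc
  refine Integrable.mono' (integrable_exp_neg_abs.const_mul C) ?_ ?_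
  · apply Continuous.aestronglyMeasurable
    rw [continuous_iff_continuousAt]
    intro y
    exact ContinuousAt.comp (f := fun y : ℝ => (σ:ℂ) + y * I) (g := wg a b c)
      (wg_diff a b c ha hb hc _ (by simpa using h0) (by simpa using h1)).continuousAt (by fun_prop)
  · refine Filter.Eventually.of_forall (fun y => ?_)
    simpa using h (σ + y * I) (by simpa using h0) (by simpa using h1)

lemma wg_shift (a b c : ℝ) (ha : 0 < a) (hb : 0 < b) (hc : 0 < c) :
    ∫ y : ℝ, wg a b c ((1:ℝ) + y * I) = ∫ y : ℝ, wg a b c ((0:ℝ) + y * I) := by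
  obtain ⟨C, hC, h⟩ := wg_bound a b c ha hb hc
  have t1 := intervalIntegral_tendsto_integral (wg_integrable a b c ha hb hc 1 zero_le_one le_rfl)
    Filter.tendsto_neg_atTop_atBot Filter.tendsto_id
  have t0 := intervalIntegral_tendsto_integral (wg_integrable a b c ha hb hc 0 le_rfl zero_le_one)
    Filter.tendsto_neg_atTop_atBot Filter.tendsto_id
  have edge : ∀ T : ℝ, ‖∫ x in (0:ℝ)..1, wg a b c (x + T * I)‖ ≤ C * Real.exp (-|T|) := by
    intro T
    have := intervalIntegral.norm_integral_le_of_norm_le_const (a := (0:ℝ)) (b := 1)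
      (f := fun x : ℝ => wg a b c (x + T * I)) (C := C * Real.exp (-|T|)) (by
        intro x hx
        rw [Set.uIoc_of_le zero_le_one] at hx
        simpa using h (x + T * I) (by simpa using hx.1.le) (by simpa using hx.2))
    simpa using this
  have hlim : Filter.Tendsto (fun T : ℝ => C * Real.exp (-|T|) + C * Real.exp (-|T|)) Filter.atTop (nhds 0) := by
    have : Filter.Tendsto (fun T : ℝ => Real.exp (-|T|)) Filter.atTop (nhds 0) :=
      Real.tendsto_exp_neg_atTop_nhds_zero.comp Filter.tendsto_abs_atTop_atTop
    simpa using (this.const_mul C).add (this.const_mul C)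
  have hz : Filter.Tendsto (fun T : ℝ => (∫ y in (-T)..T, wg a b c ((1:ℝ) + y * I)) -
      ∫ y in (-T)..T, wg a b c ((0:ℝ) + y * I)) Filter.atTop (nhds 0) := by
    refine squeeze_zero_norm (fun T => ?_) hlim
    have R := Complex.integral_boundary_rect_eq_zero_of_differentiableOn (wg a b c)
      ⟨0, -T⟩ ⟨1, T⟩ (by
        intro s hs
        have := hs.1
        simp at this
        exact (wg_diff a b c ha hb hc s this.1 this.2).differentiableWithinAt)
    simp only at R
    have e1 := edge T
    have e2 := edge (-T)
    rw [abs_neg] at e2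
    have : I * ((∫ y in (-T)..T, wg a b c ((1:ℝ) + y * I)) -
      ∫ y in (-T)..T, wg a b c ((0:ℝ) + y * I)) = (∫ x in (0:ℝ)..1, wg a b c (x + T * I)) - 
        ∫ x in (0:ℝ)..1, wg a b c (x + (-T:ℝ) * I) := by
      simp only [smul_eq_mul] at R
      linear_combination R
    have h2 := congrArg norm this
    rw [norm_mul, Complex.norm_I, one_mul] at h2
    rw [h2]
    exact (norm_sub_le _ _).trans (add_le_add e1 e2)
  exact sub_eq_zero.mp (tendsto_nhds_unique (t1.sub t0) hz)

noncomputable def wN (a y : ℝ) : ℝ := normSq (Complex.Gamma (a + y * I))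
noncomputable def wW (a b c y : ℝ) : ℝ := y * Real.sinh (2 * Real.pi * y) * (wN a y * wN b y * wN c y)
noncomputable def wF (a b c : ℝ) : ℝ := ∫ y in Set.Ioi (0:ℝ), wW a b c y

lemma wN_eq (a y : ℝ) : (wN a y : ℂ) = Complex.Gamma (a + y * I) * Complex.Gamma (a - y * I) := by
  rw [wN, ← Complex.mul_conj, ← Complex.Gamma_conj]
  congr 2
  simp; ring

lemma wN_neg (a y : ℝ) : wN a (-y) = wN a y := by
  have h1 := wN_eq a y
  have h2 := wN_eq a (-y)
  have : (wN a (-y) : ℂ) = wN a y := by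
    rw [h1, h2]; push_cast; rw [mul_comm]; congr 2 <;> ring
  exact_mod_cast this

lemma wN_succ (a y : ℝ) (ha : 0 < a) : wN (a+1) y = (a^2 + y^2) * wN a y := by
  have h0 : ((a:ℂ) + y * I) ≠ 0 := by
    intro h
    have := congrArg Complex.re h
    simp at this
    linarith
  rw [wN, wN, show ((a+1:ℝ):ℂ) + y * I = a + y * I + 1 by push_cast; ring, Complex.Gamma_add_one _ h0,
    Complex.normSq_mul, Complex.normSq_add_mul_I]

lemma wN_nonneg (a y : ℝ) : 0 ≤ wN a y := Complex.normSq_nonneg _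

lemma wW_neg (a b c y : ℝ) : wW a b c (-y) = wW a b c y := by
  simp [wW, wN_neg, Real.sinh_neg]

lemma wN_cont (a : ℝ) (ha : 0 < a) : Continuous (wN a) := by
  unfold wN
  refine Complex.continuous_normSq.comp ?_
  rw [continuous_iff_continuousAt]
  intro y
  exact ContinuousAt.comp (f := fun y : ℝ => (a:ℂ) + y * I) (g := Complex.Gamma)
      (Complex.continuousAt_Gamma _ (gz_ne _ (by simpa using ha))) (by fun_prop)

lemma wW_integrable (a b c : ℝ) (ha : 0 < a) (hb : 0 < b) (hc : 0 < c) : Integrable (wW a b c) := by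
  obtain ⟨A, hA, h1⟩ := Gamma_strip_bound a a ha
  obtain ⟨B, hB, h2⟩ := Gamma_strip_bound b b hb
  obtain ⟨D, hD, h3⟩ := Gamma_strip_bound c c hc
  have cA := wN_cont a ha
  have cB := wN_cont b hb
  have cC := wN_cont c hc
  have cW : Continuous (wW a b c) := by
    unfold wW
    fun_prop
  refine Integrable.mono' (integrable_exp_neg_abs.const_mul (5 * (A * B * D)^2)) cW.aestronglyMeasurable ?_
  refine Filter.Eventually.of_forall (fun y => ?_)
  have A1 := h1 (a + y * I) (by simp) (by simp)
  have B1 := h2 (b + y * I) (by simp) (by simp)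
  have D1 := h3 (c + y * I) (by simp) (by simp)
  have hi : ∀ u : ℝ, ((u:ℂ) + y * I).im = y := by simp
  rw [hi] at A1 B1 D1
  have hs : |Real.sinh (2 * Real.pi * y)| ≤ Real.exp (2 * Real.pi * |y|) := by
    have e : Real.sinh (2 * Real.pi * |y|) ≤ Real.exp (2 * Real.pi * |y|) := by
      rw [Real.sinh_eq]
      have := Real.exp_pos (2 * Real.pi * |y|)
      have := Real.exp_pos (-(2 * Real.pi * |y|))
      linarith
    rw [Real.abs_sinh, abs_mul, abs_of_pos (by positivity : 0 < 2 * Real.pi)]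
    exact e
  have hy : |y| ≤ 5 * Real.exp (1/5 * |y|) := by
    have := Real.add_one_le_exp (1/5 * |y|)
    linarith
  unfold wW wN
  rw [Real.norm_eq_abs, abs_mul, abs_mul, abs_of_nonneg (mul_nonneg (mul_nonneg (Complex.normSq_nonneg (Complex.Gamma (a + y * I))) (Complex.normSq_nonneg (Complex.Gamma (b + y * I)))) (Complex.normSq_nonneg (Complex.Gamma (c + y * I)))),
    Complex.normSq_eq_norm_sq, Complex.normSq_eq_norm_sq, Complex.normSq_eq_norm_sq]
  set E := Real.exp (-(5/4 * |y|)) with hE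
  calc _ ≤ (5 * Real.exp (1/5 * |y|)) * Real.exp (2 * Real.pi * |y|) * ((A * E)^2 * (B * E)^2 * (D * E)^2) := by
        gcongr
    _ = 5 * (A * B * D)^2 * (Real.exp (1/5 * |y|) * Real.exp (2 * Real.pi * |y|) * E ^ 6) := by ring
    _ ≤ _ := by
        gcongr
        rw [hE, ← Real.exp_nat_mul, ← Real.exp_add, ← Real.exp_add]
        apply Real.exp_le_exp.mpr
        push_cast
        nlinarith [abs_nonneg y, Real.pi_lt_d2]

lemma wF_eq (a b c : ℝ) : ∫ y, wW a b c y = 2 * wF a b c := by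
  rw [wF, ← integral_comp_abs]
  congr 1; ext y
  rcases abs_cases y with h | h <;> rw [h.1]
  rw [wW_neg]

lemma wg_diff_eq (a b c : ℝ) (ha : 0 < a) (hb : 0 < b) (hc : 0 < c) (y : ℝ) :
    wg a b c ((1:ℝ) + y * I) - wg a b c ((0:ℝ) + y * I) =
      ((2 * (wW a b (c+1) y - (c + a) * (c + b) * wW a b c y) : ℝ) : ℂ) := by
  have hne : ∀ u : ℝ, 0 < u → ∀ v : ℝ, ((u:ℂ) + v * I) ≠ 0 := by
    intro u hu v h
    have := congrArg Complex.re h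
    simp at this
    linarith
  have g1 : ∀ u : ℝ, 0 < u → Complex.Gamma (u + ((1:ℝ) + y * I)) = (u + y * I) * Complex.Gamma (u + y * I) := by
    intro u hu
    rw [← Complex.Gamma_add_one _ (hne u hu y)]; congr 1; push_cast; ring
  have g2 : ∀ u : ℝ, 0 < u → Complex.Gamma (u + 1 - ((0:ℝ) + y * I)) = (u - y * I) * Complex.Gamma (u - y * I) := by
    intro u hu
    have := hne u hu (-y)
    have h2 : (u:ℂ) - y * I ≠ 0 := by
      intro h; apply this; rw [← h]; push_cast; ring
    rw [← Complex.Gamma_add_one _ h2]; congr 1; push_cast; ring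
  have g3 : ∀ u : ℝ, Complex.Gamma (u + 1 - ((1:ℝ) + y * I)) = Complex.Gamma (u - y * I) := by
    intro u; congr 1; push_cast; ring
  have g4 : ∀ u : ℝ, Complex.Gamma (u + ((0:ℝ) + y * I)) = Complex.Gamma (u + y * I) := by
    intro u; congr 1; push_cast; ring
  have s1 : Complex.sin (2 * Real.pi * ((0:ℝ) + y * I)) = Complex.sinh (2 * Real.pi * y) * I := by
    rw [← Complex.sin_mul_I]; congr 1; push_cast; ring
  have s2 : Complex.sin (2 * Real.pi * ((1:ℝ) + y * I)) = Complex.sinh (2 * Real.pi * y) * I := by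
    rw [← s1, ← Complex.sin_add_two_pi (2 * Real.pi * ((0:ℝ) + y * I))]; congr 1; push_cast; ring
  unfold wg
  rw [g1 a ha, g1 b hb, g1 c hc, g2 a ha, g2 b hb, g2 c hc, g3, g3, g3, g4, g4, g4, s1, s2]
  unfold wW
  rw [wN_succ c y hc]
  push_cast
  rw [wN_eq, wN_eq, wN_eq]
  generalize Complex.Gamma (a + y * I) = A
  generalize Complex.Gamma (a - y * I) = A'
  generalize Complex.Gamma (b + y * I) = B
  generalize Complex.Gamma (b - y * I) = B'
  generalize Complex.Gamma (c + y * I) = D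
  generalize Complex.Gamma (c - y * I) = D'
  generalize Complex.sinh (2 * Real.pi * y) = S
  have hI : I^2 = -1 := Complex.I_sq
  have hI4 : I^4 = 1 := by rw [show (4:ℕ) = 2*2 by norm_num, pow_mul, hI]; norm_num
  ring_nf
  rw [hI, hI4]
  ring

lemma wF_succ (a b c : ℝ) (ha : 0 < a) (hb : 0 < b) (hc : 0 < c) :
    wF a b (c+1) = (a + c) * (b + c) * wF a b c := by
  have h := wg_shift a b c ha hb hc
  rw [← sub_eq_zero, ← integral_sub (wg_integrable a b c ha hb hc 1 zero_le_one le_rfl)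
    (wg_integrable a b c ha hb hc 0 le_rfl zero_le_one)] at h
  simp_rw [wg_diff_eq a b c ha hb hc] at h
  rw [integral_complex_ofReal, Complex.ofReal_eq_zero, integral_const_mul, integral_sub
    (wW_integrable a b (c+1) ha hb (by linarith)) ((wW_integrable a b c ha hb hc).const_mul _),
    integral_const_mul, wF_eq, wF_eq] at h
  linarith

lemma wF_comm12 (a b c : ℝ) : wF a b c = wF b a c := by
  unfold wF wW; congr 1; ext y; ring

lemma wF_comm23 (a b c : ℝ) : wF a b c = wF a c b := by
  unfold wF wW; congr 1; ext y; ring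

lemma wF_mono (a b c d : ℝ) (ha : 0 < a) (hb : 0 < b) (hc : 0 < c) (hcd : c ≤ d) :
    wF a b c * Real.Gamma d ^ 2 ≤ wF a b d * Real.Gamma c ^ 2 := by
  have hd : 0 < d := hc.trans_le hcd
  unfold wF
  rw [← integral_mul_const, ← integral_mul_const]
  refine setIntegral_mono_on ((wW_integrable a b c ha hb hc).mul_const _).integrableOn
    ((wW_integrable a b d ha hb hd).mul_const _).integrableOn measurableSet_Ioi ?_
  intro y hy
  have hy : 0 < y := hy
  have h := norm_Gamma_mono c d y hc hcd
  have h2 : wN c y * Real.Gamma d ^ 2 ≤ wN d y * Real.Gamma c ^ 2 := by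
    unfold wN
    rw [Complex.normSq_eq_norm_sq, Complex.normSq_eq_norm_sq, ← mul_pow, ← mul_pow]
    have := (Real.Gamma_pos_of_pos hd).le
    gcongr
  have hs : 0 ≤ Real.sinh (2 * Real.pi * y) := Real.sinh_nonneg_iff.mpr (by positivity)
  have h3 : 0 ≤ y * Real.sinh (2 * Real.pi * y) * (wN a y * wN b y) :=
    mul_nonneg (by positivity) (mul_nonneg (wN_nonneg _ _) (wN_nonneg _ _))
  have := mul_le_mul_of_nonneg_left h2 h3
  unfold wW
  linarith

noncomputable def wr (a b c : ℝ) : ℝ := wF a b c / (Real.Gamma (a + c) * Real.Gamma (b + c))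

lemma wr_add_nat (a b c : ℝ) (ha : 0 < a) (hb : 0 < b) (hc : 0 < c) (n : ℕ) :
    wr a b (c + n) = wr a b c := by
  induction n with
  | zero => simp
  | succ n ih =>
    rw [← ih]
    have hn : (0:ℝ) ≤ n := by positivity
    have h := wF_succ a b (c + n) ha hb (by positivity)
    unfold wr
    rw [show c + ((n+1:ℕ):ℝ) = c + n + 1 by push_cast; ring, h,
      show a + (c + n + 1) = (a + (c + n)) + 1 by ring, show b + (c + n + 1) = (b + (c + n)) + 1 by ring,
      Real.Gamma_add_one (by positivity), Real.Gamma_add_one (by positivity)]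
    have := Real.Gamma_pos_of_pos (by positivity : 0 < a + (c+n))
    have := Real.Gamma_pos_of_pos (by positivity : 0 < b + (c+n))
    field_simp

lemma Gamma_prod (s : ℝ) (hs : 0 < s) (n : ℕ) :
    Real.Gamma (s + n) = Real.Gamma s * ∏ j ∈ Finset.range n, (s + j) := by
  induction n with
  | zero => simp
  | succ n ih =>
    rw [Finset.prod_range_succ, ← mul_assoc, ← ih,
      show s + ((n+1:ℕ):ℝ) = s + n + 1 by push_cast; ring, Real.Gamma_add_one (by positivity)]
    ring

lemma Gamma_ratio_tendsto (s : ℝ) (hs : 0 < s) :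
    Filter.Tendsto (fun n : ℕ => Real.Gamma (s + (n+1:ℕ)) / ((n:ℝ)^s * n.factorial)) Filter.atTop (nhds 1) := by
  have hG := Real.Gamma_pos_of_pos hs
  have h := (tendsto_const_nhds (x := Real.Gamma s)).div (Real.GammaSeq_tendsto_Gamma s) hG.ne'
  rw [div_self hG.ne'] at h
  refine h.congr (fun n => ?_)
  simp only [Pi.div_apply]
  rw [Gamma_prod s hs, Real.GammaSeq, div_div_eq_mul_div]

lemma wr_le (a b c d : ℝ) (ha : 0 < a) (hb : 0 < b) (hc : 0 < c) (hcd : c ≤ d) :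
    wr a b c ≤ wr a b d := by
  have hd : 0 < d := hc.trans_le hcd
  have lim : ∀ c : ℝ, 0 < c → Filter.Tendsto (fun n : ℕ => wr a b c *
      ((Real.Gamma (a + c + (n+1:ℕ)) / ((n:ℝ)^(a+c) * n.factorial)) *
      (Real.Gamma (b + c + (n+1:ℕ)) / ((n:ℝ)^(b+c) * n.factorial)) /
      (Real.Gamma (c + (n+1:ℕ)) / ((n:ℝ)^c * n.factorial)) ^ 2)) Filter.atTop (nhds (wr a b c)) := by
    intro c hc
    have := (((Gamma_ratio_tendsto (a+c) (by positivity)).mul (Gamma_ratio_tendsto (b+c) (by positivity))).div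
      ((Gamma_ratio_tendsto c hc).pow 2) (by norm_num)).const_mul (wr a b c)
    simpa using this
  refine le_of_tendsto_of_tendsto (lim c hc) (lim d hd) ?_
  filter_upwards [Filter.eventually_gt_atTop 0] with n hn
  have hn' : (0:ℝ) < n := by exact_mod_cast hn
  have e : ∀ c : ℝ, 0 < c → wr a b c *
      ((Real.Gamma (a + c + (n+1:ℕ)) / ((n:ℝ)^(a+c) * n.factorial)) *
      (Real.Gamma (b + c + (n+1:ℕ)) / ((n:ℝ)^(b+c) * n.factorial)) /
      (Real.Gamma (c + (n+1:ℕ)) / ((n:ℝ)^c * n.factorial)) ^ 2) =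
      wF a b (c + (n+1:ℕ)) / Real.Gamma (c + (n+1:ℕ))^2 / ((n:ℝ)^a * (n:ℝ)^b) := by
    intro c hc
    rw [← wr_add_nat a b c ha hb hc (n+1), wr, ← add_assoc, ← add_assoc, Real.rpow_add hn', Real.rpow_add hn']
    have := Real.Gamma_pos_of_pos (by positivity : 0 < a + c + (n+1:ℕ))
    have := Real.Gamma_pos_of_pos (by positivity : 0 < b + c + (n+1:ℕ))
    have := Real.Gamma_pos_of_pos (by positivity : 0 < c + (n+1:ℕ))
    have : 0 < (n:ℝ)^a := by positivity
    have : 0 < (n:ℝ)^b := by positivity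
    have : 0 < (n:ℝ)^c := by positivity
    field_simp
  rw [e c hc, e d hd]
  have g1 := Real.Gamma_pos_of_pos (by positivity : 0 < c + (n+1:ℕ))
  have g2 := Real.Gamma_pos_of_pos (by positivity : 0 < d + (n+1:ℕ))
  have := wF_mono a b (c + (n+1:ℕ)) (d + (n+1:ℕ)) ha hb (by positivity) (by gcongr)
  gcongr ?_ / _
  rw [div_le_div_iff₀ (by positivity) (by positivity)]
  exact this

lemma wr_const (a b c d : ℝ) (ha : 0 < a) (hb : 0 < b) (hc : 0 < c) (hd : 0 < d) :
    wr a b c = wr a b d := by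
  have key : ∀ c d : ℝ, 0 < c → 0 < d → wr a b c ≤ wr a b d := by
    intro c d hc hd
    obtain ⟨n, hn⟩ := exists_nat_ge c
    rw [← wr_add_nat a b d ha hb hd n]
    exact wr_le a b c _ ha hb hc (by linarith)
  exact le_antisymm (key c d hc hd) (key d c hd hc)

noncomputable def wK (a b c : ℝ) : ℝ :=
  wF a b c / (Real.Gamma (a + b) * Real.Gamma (a + c) * Real.Gamma (b + c))

lemma wK_const (a b c d : ℝ) (ha : 0 < a) (hb : 0 < b) (hc : 0 < c) (hd : 0 < d) :
    wK a b c = wK a b d := by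
  have h := wr_const a b c d ha hb hc hd
  have e : ∀ c, wK a b c = wr a b c / Real.Gamma (a + b) := by
    intro c
    rw [wK, wr, div_div]; congr 1; ring
  rw [e, e, h]

lemma wK_comm12 (a b c : ℝ) : wK a b c = wK b a c := by
  rw [wK, wK, wF_comm12, add_comm b a]; congr 1; ring

lemma wK_comm23 (a b c : ℝ) : wK a b c = wK a c b := by
  rw [wK, wK, wF_comm23, add_comm c b]; congr 1; ring

lemma wK_eq (a b c : ℝ) (ha : 0 < a) (hb : 0 < b) (hc : 0 < c) : wK a b c = wK 1 1 (1/2) := by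
  rw [wK_const a b c 1 ha hb hc one_pos, wK_comm23, wK_const a 1 b 1 ha one_pos hb one_pos,
    wK_comm12, wK_comm23, wK_const 1 1 a (1/2) one_pos one_pos ha (by norm_num)]

lemma odd_four : HasSum (fun n : ℕ => 1 / ((2 * n + 1 : ℝ))^4) (Real.pi^4 / 96) := by
  have h := hasSum_zeta_four
  set f : ℕ → ℝ := fun n => 1 / (n:ℝ)^4 with hf
  have he : HasSum (fun n : ℕ => f (2 * n)) (Real.pi^4/90/16) := by
    have e : (fun n : ℕ => f (2 * n)) = fun n => f n / 16 := by
      ext n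
      simp only [hf]; push_cast
      rw [mul_pow, div_div]; congr 1; ring
    rw [e]
    exact h.div_const 16
  have ho : Summable (fun n : ℕ => f (2 * n + 1)) :=
    h.summable.comp_injective (i := fun n : ℕ => 2 * n + 1) (fun x y hxy => by simpa using hxy)
  have hu := (HasSum.even_add_odd he ho.hasSum).unique h
  have h2 := ho.hasSum
  rw [show ∑' (n : ℕ), f (2 * n + 1) = Real.pi^4 / 96 by linarith] at h2
  have e2 : (fun n : ℕ => 1 / ((2 * n + 1 : ℝ))^4) = fun n : ℕ => f (2 * n + 1) := by
    ext n
    simp only [hf]; push_cast; rfl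
  rw [e2]
  exact h2

lemma base_integral : ∫ y in Set.Ioi (0:ℝ), y^3 / Real.sinh (Real.pi * y) = 1/8 := by
  have hm := hasSum_mellin (ι := ℕ) (a := fun _ => 1) (p := fun n => (2 * n + 1) * Real.pi)
    (F := fun t => ((1 / (2 * Real.sinh (Real.pi * t)) : ℝ) : ℂ)) (s := 4)
    (fun i => Or.inr (by positivity)) (by norm_num) (by
      intro t ht
      have ht : 0 < t := ht
      have hq : Real.exp (-(2 * Real.pi * t)) < 1 := by
        rw [Real.exp_lt_one_iff]; simp; positivity
      have g := (hasSum_geometric_of_lt_one (Real.exp_pos _).le hq).mul_left (Real.exp (-(Real.pi * t)))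
      have g2 : HasSum (fun i : ℕ => Real.exp (-((2 * i + 1) * Real.pi) * t)) (1 / (2 * Real.sinh (Real.pi * t))) := by
        convert! g using 1
        · ext i
          rw [← Real.exp_nat_mul, ← Real.exp_add]; congr 1; ring
        · rw [Real.sinh_eq, show -(2 * Real.pi * t) = -(Real.pi * t) + -(Real.pi * t) by ring, Real.exp_add, Real.exp_neg]
          have h1 : 1 < Real.exp (Real.pi * t) := Real.one_lt_exp_iff.mpr (by positivity)
          generalize Real.exp (Real.pi * t) = u at *
          have : u^2 - 1 ≠ 0 := by nlinarith
          have : u - u⁻¹ ≠ 0 := by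
            intro h; apply this; field_simp at h; linarith
          have : 1 - u⁻¹ * u⁻¹ ≠ 0 := by
            intro h; field_simp at h; simp_all
          field_simp
      simpa using Complex.hasSum_ofReal.mpr g2) (by
      have := (odd_four.div_const (Real.pi^4)).summable
      refine this.congr (fun n => ?_)
      norm_num
      rw [mul_pow]; field_simp)
  have h2 : HasSum (fun n : ℕ => ((6 * (1 / ((2 * n + 1 : ℝ))^4) / Real.pi^4 : ℝ) : ℂ)) ((1/16 : ℝ) : ℂ) := by
    rw [Complex.hasSum_ofReal]
    convert! (odd_four.mul_left 6).div_const (Real.pi^4) using 1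
    have := Real.pi_ne_zero
    field_simp; norm_num
  have h3 : mellin (fun t => ((1 / (2 * Real.sinh (Real.pi * t)) : ℝ) : ℂ)) 4 = ((1/16:ℝ):ℂ) := by
    refine hm.unique (h2.congr_fun ?_)
    intro n
    have : Complex.Gamma 4 = 6 := by
      have := Complex.Gamma_nat_eq_factorial 3
      rw [show (((3:ℕ):ℂ) + 1) = 4 by norm_num] at this
      rw [this]; norm_num [Nat.factorial]
    rw [this]
    rw [show (4:ℂ) = ((4:ℕ):ℂ) by norm_num, Complex.cpow_natCast]
    push_cast
    rw [mul_pow]; field_simp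
  have h4 : mellin (fun t => ((1 / (2 * Real.sinh (Real.pi * t)) : ℝ) : ℂ)) 4 = 
     ((∫ y in Set.Ioi (0:ℝ), (y^3 / Real.sinh (Real.pi * y)) / 2 : ℝ) : ℂ) := by
    rw [mellin, ← integral_complex_ofReal]
    congr 1; ext t
    rw [show (4:ℂ) - 1 = ((3:ℕ):ℂ) by norm_num, Complex.cpow_natCast, smul_eq_mul]
    push_cast
    ring
  rw [h4, Complex.ofReal_inj, integral_div] at h3
  linarith

lemma wF_base : wF 1 1 (1/2) = Real.pi^3 / 4 := by
  have : wF 1 1 (1/2) = ∫ y in Set.Ioi (0:ℝ), (2 * Real.pi^3) * (y^3 / Real.sinh (Real.pi * y)) := by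
    refine setIntegral_congr_fun measurableSet_Ioi (fun y hy => ?_)
    have hy : 0 < y := hy
    have hs : 0 < Real.sinh (Real.pi * y) := Real.sinh_pos_iff.mpr (by positivity)
    have hcs := Real.cosh_pos (Real.pi * y)
    simp only [wW, wN]
    rw [normSq_Gamma_one y hy.ne', normSq_Gamma_half, mul_assoc 2, Real.sinh_two_mul]
    field_simp
  rw [this, integral_const_mul, base_integral]
  ring

lemma wK_base : wK 1 1 (1/2) = Real.pi ^ 2 := by
  rw [wK, wF_base, show (1:ℝ) + 1/2 = 1/2 + 1 by norm_num, Real.Gamma_add_one (s := 1/2) (by norm_num),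
    Real.Gamma_one_half_eq, show (1:ℝ) + 1 = 2 by norm_num, Real.Gamma_two]
  have := Real.pi_pos
  have h := Real.sq_sqrt this.le
  rw [show (1 * (1/2 * Real.sqrt Real.pi) * (1/2 * Real.sqrt Real.pi)) = Real.sqrt Real.pi ^ 2 / 4 by ring, h]
  field_simp

/-- The limit case of the Wilson integral. -/
theorem wilson_integral_limit_case (a b c : ℝ) (ha : 0 < a) (hb : 0 < b)
    (hc : 0 < c) :
    (1 / (4 * Real.pi^2)) *
      ∫ τ in Set.Ioi (0:ℝ), τ * Real.sinh (Real.pi * τ) *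
        Complex.normSq
          (Complex.Gamma (a + τ/2 * Complex.I) * Complex.Gamma (b + τ/2 * Complex.I) *
            Complex.Gamma (c + τ/2 * Complex.I))
      = Real.Gamma (a+b) * Real.Gamma (a+c) * Real.Gamma (b+c) := by
  have h := wK_eq a b c ha hb hc
  have g1 := Real.Gamma_pos_of_pos (by positivity : 0 < a + b)
  have g2 := Real.Gamma_pos_of_pos (by positivity : 0 < a + c)
  have g3 := Real.Gamma_pos_of_pos (by positivity : 0 < b + c)
  rw [wK_base, wK, div_eq_iff (by positivity)] at h
  have hi := integral_comp_mul_left_Ioi' (fun τ : ℝ => τ * Real.sinh (Real.pi * τ) *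
        Complex.normSq
          (Complex.Gamma (a + τ/2 * Complex.I) * Complex.Gamma (b + τ/2 * Complex.I) *
            Complex.Gamma (c + τ/2 * Complex.I))) 0 (two_pos)
  rw [mul_zero] at hi
  rw [← hi]
  have e : ∀ x : ℝ, (2 * x) * Real.sinh (Real.pi * (2 * x)) *
        Complex.normSq
          (Complex.Gamma (a + ((2 * x : ℝ) : ℂ)/2 * Complex.I) * Complex.Gamma (b + ((2 * x : ℝ) : ℂ)/2 * Complex.I) *
            Complex.Gamma (c + ((2 * x : ℝ) : ℂ)/2 * Complex.I)) = 2 * wW a b c x := by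
    intro x
    rw [show ((2 * x : ℝ) : ℂ)/2 = x by push_cast; ring, Complex.normSq_mul, Complex.normSq_mul, wW, wN, wN, wN,
      show Real.pi * (2 * x) = 2 * Real.pi * x by ring]
    ring
  simp_rw [e]
  rw [integral_const_mul, smul_eq_mul]
  change 1 / (4 * Real.pi^2) * (2 * (2 * wF a b c)) = _
  rw [h]
  have := Real.pi_pos
  field_simp
  norm_num
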